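/- Let ℓ ≥ 1, let σ : ℝ → ℝ be continuous, odd and strictly increasing, let W : ℝ → ℝ be continuous with W(x) > 0 for all x ∈ ℝ, let τ > 0 and T = 4τ, and consider the path dynamics with input P⁰(t) = Q(t − T/2) and initial fluxes φ₀^1, …, φ₀^ℓ ∈ ℝ. Then: (1) φ^κ(0) = φ^κ(T/2) = φ^κ(T) for every κ ∈ {1, …, ℓ}; and (2) if φ̄₀^ℓ ∈ ℝ is another initial flux for the ℓ-th memristor (with the same φ₀^1, …, φ₀^{ℓ−1}) such that the resulting currents satisfy J^ℓ(t; φ₀^ℓ) = J^ℓ(t; φ̄₀^ℓ) for all t ∈ [0,T], then W(φ₀^ℓ) = W(φ̄₀^ℓ). -/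

import Mathlib

/-- The block signal: `Q t = 0` for `t < -2τ`, `-1` for `-2τ ≤ t < -τ`,
`1` for `-τ ≤ t ≤ τ`, `-1` for `τ < t ≤ 2τ` and `0` for `t > 2τ`. -/
noncomputable def blockSignal (τ : ℝ) (t : ℝ) : ℝ :=
  if t < -(2 * τ) then 0
  else if t < -τ then -1
  else if t ≤ τ then 1
  else if t ≤ 2 * τ then -1
  else 0

open MeasureTheory in
theorem aux_sym (p : ℝ → ℝ) (hp : ∀ a b, IntervalIntegrable p volume a b) (c r : ℝ)
    (hanti : ∀ x, |x - c| ≤ r → x ≠ c → p (2 * c - x) = - p x) (t : ℝ) (ht : |t - c| ≤ r) :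
    ∫ s in (0:ℝ)..(2 * c - t), p s = ∫ s in (0:ℝ)..t, p s := by
  have h1 := intervalIntegral.integral_add_adjacent_intervals (hp 0 t) (hp t (2 * c - t))
  have h2 : ∫ s in t..(2 * c - t), p (2 * c - s) = ∫ s in t..(2 * c - t), p s := by
    rw [intervalIntegral.integral_comp_sub_left (fun x => p x) (2 * c)]
    simp
  have h3 : ∫ s in t..(2 * c - t), p (2 * c - s) = ∫ s in t..(2 * c - t), - p s := by
    apply intervalIntegral.integral_congr_ae
    have hc : ∀ᵐ x ∂(volume : Measure ℝ), x ≠ c := by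
      simp [ae_iff]
    filter_upwards [hc] with x hx hmem
    apply hanti x _ hx
    have hm := Set.uIoc_subset_uIcc hmem
    rw [Set.mem_uIcc] at hm
    rw [abs_le] at ht ⊢
    rcases hm with hm | hm <;> constructor <;> linarith [hm.1, hm.2, ht.1, ht.2]
  rw [intervalIntegral.integral_neg] at h3
  linarith

theorem aux_cases (τ t : ℝ) :
    blockSignal τ t = 0 ∨ blockSignal τ t = 1 ∨ blockSignal τ t = -1 := by
  unfold blockSignal
  split_ifs <;> simp

theorem aux_meas (τ : ℝ) : Measurable (blockSignal τ) := by
  unfold blockSignal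
  refine Measurable.ite measurableSet_Iio measurable_const ?_
  refine Measurable.ite measurableSet_Iio measurable_const ?_
  refine Measurable.ite measurableSet_Iic measurable_const ?_
  exact Measurable.ite measurableSet_Iic measurable_const measurable_const

open MeasureTheory in
theorem aux_int (τ d a b : ℝ) :
    IntervalIntegrable (fun t => blockSignal τ (t - d)) volume a b := by
  refine (intervalIntegrable_const (c := (1:ℝ))).mono_fun
    ((aux_meas τ).comp (measurable_id.sub_const d)).aestronglyMeasurable ?_
  refine Filter.Eventually.of_forall fun t => ?_
  rcases aux_cases τ (t - d) with h | h | h <;> simp [h]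

theorem aux_anti1 (τ x : ℝ) (hx : |x - τ| ≤ τ) (hne : x ≠ τ) :
    blockSignal τ (2 * τ - x - 2 * τ) = - blockSignal τ (x - 2 * τ) := by
  rw [abs_le] at hx
  rcases lt_or_gt_of_ne hne with h | h <;> unfold blockSignal <;> split_ifs <;>
    first | linarith | norm_num

theorem aux_anti2 (τ x : ℝ) (hx : |x - 3 * τ| ≤ τ) (hne : x ≠ 3 * τ) :
    blockSignal τ (2 * (3 * τ) - x - 2 * τ) = - blockSignal τ (x - 2 * τ) := by
  rw [abs_le] at hx
  rcases lt_or_gt_of_ne hne with h | h <;> unfold blockSignal <;> split_ifs <;>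
    first | linarith | norm_num

/-- The invariant: `p` is the block input times a positive continuous function, symmetric about
`τ` and `3τ` on the corresponding half periods. -/
def AuxInv (τ : ℝ) (p : ℝ → ℝ) : Prop :=
  ∃ F : ℝ → ℝ, Continuous F ∧ (∀ t, 0 < F t) ∧
    (∀ t, |t - τ| ≤ τ → F (2 * τ - t) = F t) ∧
    (∀ t, |t - 3 * τ| ≤ τ → F (2 * (3 * τ) - t) = F t) ∧
    ∀ t, p t = blockSignal τ (t - 2 * τ) * F t

open MeasureTheory in
theorem AuxInv.int {τ : ℝ} {p : ℝ → ℝ} (h : AuxInv τ p) (a b : ℝ) :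
    IntervalIntegrable p volume a b := by
  obtain ⟨F, hF, -, -, -, hp⟩ := h
  rw [funext hp]
  exact (aux_int τ (2 * τ) a b).mul_continuousOn hF.continuousOn

theorem AuxInv.sym1 {τ : ℝ} {p : ℝ → ℝ} (h : AuxInv τ p) (t : ℝ) (ht : |t - τ| ≤ τ) :
    ∫ s in (0:ℝ)..(2 * τ - t), p s = ∫ s in (0:ℝ)..t, p s := by
  refine aux_sym p h.int τ τ (fun x hx hne => ?_) t ht
  obtain ⟨F, hF, -, h1, -, hp⟩ := h
  rw [hp, hp, h1 x hx, aux_anti1 τ x hx hne]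
  ring

theorem AuxInv.sym2 {τ : ℝ} {p : ℝ → ℝ} (h : AuxInv τ p) (t : ℝ) (ht : |t - 3 * τ| ≤ τ) :
    ∫ s in (0:ℝ)..(2 * (3 * τ) - t), p s = ∫ s in (0:ℝ)..t, p s := by
  refine aux_sym p h.int (3 * τ) τ (fun x hx hne => ?_) t ht
  obtain ⟨F, hF, -, -, h1, hp⟩ := h
  rw [hp, hp, h1 x hx, aux_anti2 τ x hx hne]
  ring

/-- reading: for the path dynamics
`φ^κ(t) = φ₀^κ + ∫₀ᵗ P^{κ−1}`, `J^κ(t) = W(φ^κ(t)) P^{κ−1}(t)`, `P^κ = σ(J^κ)`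
driven by the block input `P⁰(t) = Q(t − T/2)` with `T = 4τ`:
(1) `φ^κ(0) = φ^κ(T/2) = φ^κ(T)` for all `κ ∈ {1,…,ℓ}`; and
(2) if another initial flux `φb₀` for the `ℓ`-th memristor (same `φ₀^1,…,φ₀^{ℓ−1}`)
produces the same current `J^ℓ` on `[0,T]`, then `W(φ₀^ℓ) = W(φb₀)`. -/
theorem reading_block_signal (ℓ : ℕ) (hℓ : 1 ≤ ℓ)
    (σ W : ℝ → ℝ) (hσc : Continuous σ) (hσodd : ∀ x, σ (-x) = -σ x)
    (hσmono : StrictMono σ) (hWc : Continuous W) (hWpos : ∀ x, 0 < W x)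
    (τ T : ℝ) (hτ : 0 < τ) (hT : T = 4 * τ)
    (φ₀ : ℕ → ℝ) (φ P J : ℕ → ℝ → ℝ)
    (hP0 : ∀ t, P 0 t = blockSignal τ (t - T / 2))
    (hφ : ∀ κ, 1 ≤ κ → κ ≤ ℓ → ∀ t, φ κ t = φ₀ κ + ∫ s in (0:ℝ)..t, P (κ - 1) s)
    (hJ : ∀ κ, 1 ≤ κ → κ ≤ ℓ → ∀ t, J κ t = W (φ κ t) * P (κ - 1) t)
    (hPk : ∀ κ, 1 ≤ κ → κ ≤ ℓ → ∀ t, P κ t = σ (J κ t)) :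
    (∀ κ, 1 ≤ κ → κ ≤ ℓ → φ κ 0 = φ κ (T / 2) ∧ φ κ (T / 2) = φ κ T) ∧
    (∀ (φb₀ : ℝ) (φb Jb : ℝ → ℝ),
      (∀ t, φb t = φb₀ + ∫ s in (0:ℝ)..t, P (ℓ - 1) s) →
      (∀ t, Jb t = W (φb t) * P (ℓ - 1) t) →
      (∀ t ∈ Set.Icc (0:ℝ) T, J ℓ t = Jb t) →
      W (φ₀ ℓ) = W φb₀) := by
  have h2 : T / 2 = 2 * τ := by rw [hT]; ring
  have hσ0 : σ 0 = 0 := by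
    have := hσodd 0
    rw [neg_zero] at this
    linarith
  have inv : ∀ κ, κ ≤ ℓ → AuxInv τ (P κ) := by
    intro κ
    induction κ with
    | zero =>
      intro _
      refine ⟨fun _ => 1, continuous_const, fun _ => one_pos, fun _ _ => rfl, fun _ _ => rfl, ?_⟩
      intro t
      rw [hP0, h2, mul_one]
    | succ n ih =>
      intro hn
      have hi := ih (by omega)
      have e := hφ (n + 1) (by omega) hn
      simp only [Nat.add_sub_cancel] at e
      have s1 : ∀ t, |t - τ| ≤ τ → φ (n + 1) (2 * τ - t) = φ (n + 1) t := fun t ht => by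
        rw [e, e, hi.sym1 t ht]
      have s2 : ∀ t, |t - 3 * τ| ≤ τ → φ (n + 1) (2 * (3 * τ) - t) = φ (n + 1) t :=
        fun t ht => by rw [e, e, hi.sym2 t ht]
      have hc : Continuous (φ (n + 1)) := by
        rw [funext e]
        exact continuous_const.add (intervalIntegral.continuous_primitive hi.int 0)
      obtain ⟨F, hF, hpos, f1, f2, hp⟩ := hi
      refine ⟨fun t => σ (W (φ (n + 1) t) * F t), hσc.comp ((hWc.comp hc).mul hF), ?_, ?_, ?_, ?_⟩
      · intro t
        rw [← hσ0]
        exact hσmono (mul_pos (hWpos _) (hpos t))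
      · intro t ht
        simp only [s1 t ht, f1 t ht]
      · intro t ht
        simp only [s2 t ht, f2 t ht]
      · intro t
        rw [hPk (n + 1) (by omega) hn, hJ (n + 1) (by omega) hn, Nat.add_sub_cancel, hp]
        rcases aux_cases τ (t - 2 * τ) with h | h | h <;> simp [h, hσ0, hσodd]
  constructor
  · intro κ h1 hκ
    have hi := inv (κ - 1) (by omega)
    have a1 := hi.sym1 0 (by simp [abs_of_pos hτ])
    have a2 := hi.sym2 (2 * τ) (by rw [abs_le]; constructor <;> linarith)
    rw [hφ κ h1 hκ, hφ κ h1 hκ, hφ κ h1 hκ, h2, hT]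
    rw [sub_zero] at a1
    rw [show 2 * (3 * τ) - 2 * τ = 4 * τ by ring] at a2
    rw [a2, a1]
    exact ⟨rfl, rfl⟩
  · intro φb₀ φb Jb hb hJb heq
    have h0 := heq 0 ⟨le_rfl, by linarith⟩
    obtain ⟨F, hF, hpos, -, -, hp⟩ := inv (ℓ - 1) (by omega)
    have hne : P (ℓ - 1) 0 ≠ 0 := by
      rw [hp]
      have : blockSignal τ (0 - 2 * τ) = -1 := by
        unfold blockSignal
        rw [if_neg (by linarith), if_pos (by linarith)]
      rw [this]
      have := hpos 0
      intro h
      linarith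
    rw [hJ ℓ hℓ le_rfl, hJb, hφ ℓ hℓ le_rfl, hb] at h0
    simp only [intervalIntegral.integral_same, add_zero] at h0
    exact mul_right_cancel₀ hne h0
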